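/- For all real α > -1 and -1/2 < β ≤ 0, and for every integer n ≥ 0, one has ∫₀¹ (h(r)/h(1))·r^{β+n-1}(1-r)^α dr = (𝓑(α+1, 2β+n+1)/((β+1)·𝓑(α+1, β+1))) · ∑_{k=0}^∞ ((-α)_k·(β+1)_k·(2β+n+1)_k)/((β+2)_k·(α+2β+n+2)_k·k!). -/

import Mathlib

open MeasureTheory Real Filter

/-- The Beta function. -/
noncomputable def Beta (a b : ℝ) : ℝ := Real.Gamma a * Real.Gamma b / Real.Gamma (a + b)

/-- The incomplete beta function h(r) = ∫₀^r t^β (1-t)^α dt. -/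
noncomputable def hfun (α β : ℝ) (r : ℝ) : ℝ := ∫ t in (0:ℝ)..r, t ^ β * (1 - t) ^ α

/-- The ascending factorial (Pochhammer symbol) (a)_k. -/
noncomputable def poch (a : ℝ) (k : ℕ) : ℝ := Polynomial.eval a (ascPochhammer ℝ k)

lemma poch_zero (a : ℝ) : poch a 0 = 1 := by simp [poch]

lemma poch_succ (a : ℝ) (k : ℕ) : poch a (k + 1) = poch a k * (a + k) := by
  simp [poch, ascPochhammer_succ_eval]

lemma poch_pos {a : ℝ} (ha : 0 < a) (k : ℕ) : 0 < poch a k :=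
  ascPochhammer_pos k a ha

lemma Gamma_add_nat {a : ℝ} (ha : 0 < a) (k : ℕ) :
    Real.Gamma (a + k) = poch a k * Real.Gamma a := by
  induction k with
  | zero => simp [poch_zero]
  | succ k ih =>
    have hk : a + k ≠ 0 := by positivity
    rw [Nat.cast_succ, ← add_assoc, Real.Gamma_add_one hk, ih, poch_succ]
    ring

lemma Beta_add_nat {a b : ℝ} (ha : 0 < a) (hb : 0 < b) (k : ℕ) :
    Beta a (b + k) = Beta a b * (poch b k / poch (a + b) k) := by
  have hab : 0 < a + b := by positivity
  rw [Beta, Beta, ← add_assoc, Gamma_add_nat hb, Gamma_add_nat hab]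
  have := (poch_pos hab k).ne'
  have := (Real.Gamma_pos_of_pos hab).ne'
  field_simp

lemma poch_div_poch_add_one {a : ℝ} (ha : 0 < a) (k : ℕ) :
    poch a k / poch (a + 1) k = a / (a + k) := by
  have h : poch a k * (a + k) = a * poch (a + 1) k := by
    induction k with
    | zero => simp [poch_zero]
    | succ k ih =>
      rw [poch_succ, poch_succ, ih]
      push_cast
      ring
  have := (poch_pos (by positivity : 0 < a + 1) k).ne'
  rw [div_eq_div_iff this (by positivity), h]

/-- The sign of `poch a k` is eventually constant in `k`. -/
lemma exists_abs_poch_eq (a : ℝ) :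
    ∃ ε : ℝ, ∃ K : ℕ, ∀ k, K ≤ k → |poch a k| = ε * poch a k := by
  obtain ⟨K, hK⟩ := exists_nat_gt (-a)
  obtain ⟨ε, hε⟩ : ∃ ε : ℝ, |poch a K| = ε * poch a K := by
    rcases abs_choice (poch a K) with h | h
    · exact ⟨1, by simp [h]⟩
    · exact ⟨-1, by simp [h]⟩
  refine ⟨ε, K, fun k hk => ?_⟩
  induction k, hk using Nat.le_induction with
  | base => exact hε
  | succ k hk ih =>
    have hKk : (K : ℝ) ≤ k := by exact_mod_cast hk
    rw [poch_succ, abs_mul, ih, abs_of_nonneg (by linarith : 0 ≤ a + k), mul_assoc]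

lemma hasSum_one_sub_rpow (α : ℝ) {t : ℝ} (ht : |t| < 1) :
    HasSum (fun k : ℕ => poch (-α) k / (Nat.factorial k) * t ^ k) ((1 - t) ^ α) := by
  have h := (Real.one_div_one_sub_rpow_hasFPowerSeriesOnBall_zero (-α)).hasSum (y := t)
    (by simpa [enorm_eq_nnnorm] using! ht)
  have hc (k : ℕ) : Ring.choose (-α + k - 1) k = poch (-α) k / (Nat.factorial k) := by
    have h' := Ring.factorial_nsmul_multichoose_eq_ascPochhammer (-α) k
    rw [Polynomial.ascPochhammer_smeval_eq_eval, nsmul_eq_mul] at h'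
    have hk : (Nat.factorial k : ℝ) ≠ 0 := by positivity
    rw [Ring.choose, show -α + k - 1 - k + 1 = -α by ring, poch, ← h']
    field_simp
  have h1 : 0 ≤ 1 - t := by linarith [(abs_lt.mp ht).2]
  simpa [hc, FormalMultilinearSeries.ofScalars, Real.rpow_neg h1, List.prod_ofFn] using h

lemma integrableOn_beta {a b : ℝ} (ha : 0 < a) (hb : 0 < b) :
    IntegrableOn (fun t : ℝ => t ^ (a - 1) * (1 - t) ^ (b - 1)) (Set.Ioo 0 1) := by
  have h := Complex.betaIntegral_convergent (u := a) (v := b) (by simpa) (by simpa)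
  rw [intervalIntegrable_iff_integrableOn_Ioo_of_le (by simp)] at h
  refine IntegrableOn.congr_fun h.re (fun t ht => ?_) measurableSet_Ioo
  simp only [RCLike.re_to_complex]
  norm_cast
  rw [← Complex.ofReal_cpow ht.1.le, ← Complex.ofReal_cpow (by linarith [ht.2]),
    ← Complex.ofReal_mul, Complex.ofReal_re]

lemma integral_beta {a b : ℝ} (ha : 0 < a) (hb : 0 < b) :
    ∫ t in Set.Ioo (0 : ℝ) 1, t ^ (a - 1) * (1 - t) ^ (b - 1) = Beta b a := by
  have h := Complex.betaIntegral_convergent (u := a) (v := b) (by simpa) (by simpa)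
  rw [intervalIntegrable_iff_integrableOn_Ioo_of_le (by simp)] at h
  have h2 : Beta b a = (Complex.betaIntegral a b).re := by
    rw [← ProbabilityTheory.beta_eq_betaIntegralReal a b ha hb, Beta, ProbabilityTheory.beta,
      add_comm b a, mul_comm]
  rw [h2, Complex.betaIntegral, intervalIntegral.integral_of_le (by norm_num),
    integral_Ioc_eq_integral_Ioo, ← RCLike.re_to_complex, ← integral_re h]
  refine setIntegral_congr_fun measurableSet_Ioo fun t ht => ?_
  simp only [RCLike.re_to_complex]
  norm_cast
  rw [← Complex.ofReal_cpow ht.1.le, ← Complex.ofReal_cpow (by linarith [ht.2]),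
    ← Complex.ofReal_mul, Complex.ofReal_re]

lemma integrableOn_rpow_mul_one_sub_rpow {α β : ℝ} (hα : -1 < α) (hβ : -1 < β) :
    IntegrableOn (fun t : ℝ => t ^ β * (1 - t) ^ α) (Set.Ioo 0 1) := by
  simpa using integrableOn_beta (a := β + 1) (b := α + 1) (by linarith) (by linarith)

lemma hfun_one {α β : ℝ} (hα : -1 < α) (hβ : -1 < β) : hfun α β 1 = Beta (α + 1) (β + 1) := by
  rw [← integral_beta (by linarith) (by linarith), hfun, intervalIntegral.integral_of_le zero_le_one,
    integral_Ioc_eq_integral_Ioo]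
  simp

lemma hasSum_hfun (α : ℝ) {β r : ℝ} (hβ : -1 < β) (hr : r ∈ Set.Ioo (0 : ℝ) 1) :
    HasSum (fun k : ℕ => poch (-α) k / (Nat.factorial k) * (r ^ (β + k + 1) / (β + k + 1)))
      (hfun α β r) := by
  have hsum : Summable fun k : ℕ => |poch (-α) k / (Nat.factorial k)| * r ^ k := by
    refine (hasSum_one_sub_rpow α (abs_lt.2 ⟨by linarith [hr.1], hr.2⟩)).summable.abs.congr ?_
    intro k
    rw [abs_mul, abs_pow, abs_of_pos hr.1]
  have key := intervalIntegral.hasSum_integral_of_dominated_convergence (a := 0) (b := r)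
    (μ := volume) (F := fun (k : ℕ) t => poch (-α) k / (Nat.factorial k) * t ^ (β + k))
    (f := fun t => t ^ β * (1 - t) ^ α)
    (fun k t => |poch (-α) k / (Nat.factorial k)| * r ^ k * t ^ β)
    (fun k => (Measurable.aestronglyMeasurable (by fun_prop)))
    (fun k => .of_forall fun t ht => ?_) (.of_forall fun t ht => hsum.mul_right _) ?_
    (.of_forall fun t ht => ?_)
  · refine key.congr_fun ?_
    intro k
    have : -1 < β + k := by linarith [(Nat.cast_nonneg k : (0 : ℝ) ≤ k)]
    rw [intervalIntegral.integral_const_mul, integral_rpow (.inl this),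
      Real.zero_rpow (by linarith), sub_zero]
  · rw [Set.uIoc_of_le hr.1.le] at ht
    rw [Real.norm_eq_abs, abs_mul, abs_of_nonneg (Real.rpow_nonneg ht.1.le _),
      Real.rpow_add ht.1, Real.rpow_natCast, mul_assoc, mul_comm (r ^ k)]
    have := Real.rpow_nonneg ht.1.le β
    have := ht.1.le
    have := ht.2
    gcongr
  · simp_rw [tsum_mul_right]
    exact (intervalIntegral.intervalIntegrable_rpow' hβ).const_mul _
  · rw [Set.uIoc_of_le hr.1.le] at ht
    refine ((hasSum_one_sub_rpow α (t := t) (abs_lt.2 ⟨by linarith [ht.1],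
      by linarith [ht.2, hr.2]⟩)).mul_left (t ^ β)).congr_fun fun k => ?_
    rw [Real.rpow_add ht.1, Real.rpow_natCast]
    ring

lemma hfun_nonneg (α β : ℝ) {r : ℝ} (hr : r ∈ Set.Ioo (0 : ℝ) 1) : 0 ≤ hfun α β r :=
  intervalIntegral.integral_nonneg hr.1.le fun t ht =>
    mul_nonneg (Real.rpow_nonneg ht.1 _) (Real.rpow_nonneg (by linarith [ht.2, hr.2]) _)

lemma one_sub_mul_rpow_le (α : ℝ) {r s : ℝ} (hr : r ∈ Set.Ioo (0 : ℝ) 1)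
    (hs : s ∈ Set.Ioo (0 : ℝ) 1) : (1 - r * s) ^ α ≤ (1 - s) ^ α + 1 := by
  have h1 : 0 < 1 - s := by linarith [hs.2]
  have h2 : 1 - s ≤ 1 - r * s := by nlinarith [hr.2, hs.1]
  have h3 : 1 - r * s ≤ 1 := by nlinarith [hr.1, hs.1]
  rcases le_total α 0 with h | h
  · linarith [Real.rpow_le_rpow_of_nonpos h1 h2 h]
  · linarith [Real.rpow_le_one (h1.le.trans h2) h3 h, Real.rpow_nonneg h1.le α]

lemma continuousOn_hfun {α β : ℝ} (hα : -1 < α) (hβ : -1 < β) :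
    ContinuousOn (hfun α β) (Set.Ioo 0 1) := by
  have h := integrableOn_rpow_mul_one_sub_rpow hα hβ
  rw [← integrableOn_Icc_iff_integrableOn_Ioo, ← Set.uIcc_of_le zero_le_one] at h
  refine (intervalIntegral.continuousOn_primitive_interval h).mono ?_
  rw [Set.uIcc_of_le zero_le_one]
  exact Set.Ioo_subset_Icc_self

lemma exists_hfun_le {α β : ℝ} (hα : -1 < α) (hβ : -1 < β) :
    ∃ C : ℝ, ∀ r ∈ Set.Ioo (0 : ℝ) 1, hfun α β r ≤ C * r ^ (β + 1) := by
  have hint : IntegrableOn (fun s : ℝ => s ^ β * (1 - s) ^ α + s ^ β) (Set.Ioo 0 1) := by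
    refine (integrableOn_rpow_mul_one_sub_rpow hα hβ).add ?_
    rw [← intervalIntegrable_iff_integrableOn_Ioo_of_le zero_le_one]
    exact intervalIntegral.intervalIntegrable_rpow' hβ
  refine ⟨∫ s in Set.Ioo (0 : ℝ) 1, (s ^ β * (1 - s) ^ α + s ^ β), fun r hr => ?_⟩
  have hscale : hfun α β r =
      r * ∫ s in Set.Ioo (0 : ℝ) 1, (r * s) ^ β * (1 - r * s) ^ α := by
    have := intervalIntegral.mul_integral_comp_mul_left (a := 0) (b := 1)
      (f := fun t : ℝ => t ^ β * (1 - t) ^ α) (c := r)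
    rw [mul_zero, mul_one] at this
    rw [hfun, ← this, intervalIntegral.integral_of_le zero_le_one, integral_Ioc_eq_integral_Ioo]
  have hle : ∫ s in Set.Ioo (0 : ℝ) 1, (r * s) ^ β * (1 - r * s) ^ α ≤
      ∫ s in Set.Ioo (0 : ℝ) 1, r ^ β * (s ^ β * (1 - s) ^ α + s ^ β) := by
    refine integral_mono_of_nonneg ?_ (hint.const_mul _) ?_
    · filter_upwards [self_mem_ae_restrict measurableSet_Ioo] with s hs
      have : r * s ≤ 1 := by nlinarith [hr.1, hr.2, hs.1, hs.2]
      exact mul_nonneg (Real.rpow_nonneg (mul_nonneg hr.1.le hs.1.le) _)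
        (Real.rpow_nonneg (by linarith) _)
    · filter_upwards [self_mem_ae_restrict measurableSet_Ioo] with s hs
      rw [Real.mul_rpow hr.1.le hs.1.le, mul_assoc]
      have := Real.rpow_nonneg hr.1.le β
      gcongr
      rw [← mul_add_one]
      have := Real.rpow_nonneg hs.1.le β
      gcongr
      exact one_sub_mul_rpow_le α hr hs
  rw [integral_const_mul] at hle
  rw [hscale, Real.rpow_add_one hr.1.ne']
  calc _ ≤ r * _ := mul_le_mul_of_nonneg_left hle hr.1.le
    _ = _ := by ring

lemma integrableOn_hfun_mul {α β γ : ℝ} (hα : -1 < α) (hβ : -1 < β) (hγ : -1 < β + γ + 1) :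
    IntegrableOn (fun r => hfun α β r * (r ^ γ * (1 - r) ^ α)) (Set.Ioo 0 1) := by
  obtain ⟨C, hC⟩ := exists_hfun_le hα hβ
  refine Integrable.mono' ((integrableOn_rpow_mul_one_sub_rpow hα hγ).const_mul C) ?_ ?_
  · exact ((continuousOn_hfun hα hβ).aestronglyMeasurable measurableSet_Ioo).mul
      (Measurable.aestronglyMeasurable (by fun_prop))
  · filter_upwards [self_mem_ae_restrict measurableSet_Ioo] with r hr
    have h1 : 0 ≤ r ^ γ * (1 - r) ^ α :=
      mul_nonneg (Real.rpow_nonneg hr.1.le _) (Real.rpow_nonneg (by linarith [hr.2]) _)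
    rw [Real.norm_of_nonneg (mul_nonneg (hfun_nonneg α β hr) h1)]
    calc _ ≤ C * r ^ (β + 1) * (r ^ γ * (1 - r) ^ α) :=
          mul_le_mul_of_nonneg_right (hC r hr) h1
      _ = _ := by
          rw [show β + γ + 1 = (β + 1) + γ by ring, Real.rpow_add hr.1 (β + 1)]
          ring

/-- Termwise integration of the power series of `hfun` against `r ^ γ * (1 - r) ^ α`. -/
lemma hasSum_integral_hfun_mul {α β γ : ℝ} (hα : -1 < α) (hβ : -1 < β) (hγ : -1 < β + γ + 1) :
    HasSum (fun k : ℕ => poch (-α) k / (Nat.factorial k) / (β + k + 1) *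
        Beta (α + 1) (β + γ + 2 + k))
      (∫ r in Set.Ioo (0 : ℝ) 1, hfun α β r * (r ^ γ * (1 - r) ^ α)) := by
  let F : ℕ → ℝ → ℝ := fun k r => poch (-α) k / (Nat.factorial k) / (β + k + 1) *
    (r ^ (β + γ + 1 + k) * (1 - r) ^ α)
  have hexp (k : ℕ) : -1 < β + γ + 1 + k := by
    linarith [(Nat.cast_nonneg k : (0 : ℝ) ≤ k)]
  have hden (k : ℕ) : 0 < β + k + 1 := by
    linarith [(Nat.cast_nonneg k : (0 : ℝ) ≤ k)]
  have hFint (k : ℕ) : IntegrableOn (F k) (Set.Ioo 0 1) :=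
    (integrableOn_rpow_mul_one_sub_rpow hα (hexp k)).const_mul _
  have hFsum {r : ℝ} (hr : r ∈ Set.Ioo (0 : ℝ) 1) :
      HasSum (fun k => F k r) (hfun α β r * (r ^ γ * (1 - r) ^ α)) := by
    refine ((hasSum_hfun α hβ hr).mul_right (r ^ γ * (1 - r) ^ α)).congr_fun fun k => ?_
    simp only [F]
    rw [show β + γ + 1 + k = (β + k + 1) + γ by ring, Real.rpow_add hr.1]
    ring
  obtain ⟨ε, K, hK⟩ := exists_abs_poch_eq (-α)
  have habs {r : ℝ} (hr : r ∈ Set.Ioo (0 : ℝ) 1) (k : ℕ) (hk : K ≤ k) :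
      |F k r| = ε * F k r := by
    have h1 : 0 ≤ r ^ (β + γ + 1 + k) * (1 - r) ^ α :=
      mul_nonneg (Real.rpow_nonneg hr.1.le _) (Real.rpow_nonneg (by linarith [hr.2]) _)
    simp only [F]
    rw [abs_mul, abs_of_nonneg h1, abs_div, abs_div, hK k hk, Nat.abs_cast,
      abs_of_pos (hden k)]
    ring
  have hbound {r : ℝ} (hr : r ∈ Set.Ioo (0 : ℝ) 1) :
      ε * (hfun α β r * (r ^ γ * (1 - r) ^ α)) + ∑ k ∈ Finset.range K, (|F k r| - ε * F k r) =
        ∑' k, |F k r| := by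
    have h := (hFsum hr).mul_left ε
    have h2 : HasSum _ _ := hasSum_sum_of_ne_finset_zero (L := .unconditional ℕ)
      (f := fun k => |F k r| - ε * F k r)
      (s := Finset.range K) fun k hk => by
        rw [habs hr k (by simpa using hk), sub_self]
    have h3 := h.add h2
    simp only [add_sub_cancel] at h3
    exact h3.tsum_eq.symm
  have key := hasSum_integral_of_dominated_convergence (μ := volume.restrict (Set.Ioo (0 : ℝ) 1))
    (F := F) (f := fun r => hfun α β r * (r ^ γ * (1 - r) ^ α)) (fun k r => |F k r|)
    (fun k => (hFint k).aestronglyMeasurable) (fun k => .of_forall fun r => le_rfl)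
    (by
      filter_upwards [self_mem_ae_restrict measurableSet_Ioo] with r hr
      exact (hFsum hr).summable.abs)
    (by
      refine IntegrableOn.congr_fun ?_ (fun r hr => hbound hr) measurableSet_Ioo
      exact ((integrableOn_hfun_mul hα hβ hγ).const_mul ε).add
        (integrable_finsetSum _ fun k _ => (hFint k).abs.sub ((hFint k).const_mul ε)))
    (by
      filter_upwards [self_mem_ae_restrict measurableSet_Ioo] with r hr
      exact hFsum hr)
  refine key.congr_fun fun k => ?_
  simp only [F]
  rw [integral_const_mul, ← integral_beta (by linarith [hexp k]) (by linarith)]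
  rw [show β + γ + 2 + k - 1 = β + γ + 1 + k by ring, add_sub_cancel_right]

/-- ∫₀¹ (h(r)/h(1))·r^{β+n-1}(1-r)^α dr
= 𝓑(α+1,2β+n+1)/((β+1)𝓑(α+1,β+1)) · ₃F₂(-α, β+1, 2β+n+1; β+2, α+2β+n+2; 1). -/
theorem In_hypergeometric (α β : ℝ) (hα : -1 < α) (hβ1 : -(1/2 : ℝ) < β) (hβ2 : β ≤ 0)
    (n : ℕ) :
    ∫ r in (0:ℝ)..1, (hfun α β r / hfun α β 1) * r ^ (β + (n:ℝ) - 1) * (1 - r) ^ α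
      = Beta (α+1) (2*β + n + 1) / ((β+1) * Beta (α+1) (β+1)) *
        ∑' k : ℕ, (poch (-α) k * poch (β+1) k * poch (2*β + n + 1) k) /
          (poch (β+2) k * poch (α + 2*β + n + 2) k * (Nat.factorial k)) := by
  have hβ : -1 < β := by linarith
  have hn : (0 : ℝ) ≤ n := Nat.cast_nonneg n
  have hb : 0 < 2 * β + n + 1 := by linarith
  have h := hasSum_integral_hfun_mul (γ := β + n - 1) hα hβ (by linarith)
  have hterm (k : ℕ) : poch (-α) k / (Nat.factorial k) / (β + k + 1) *
      Beta (α + 1) (β + (β + n - 1) + 2 + k) =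
      Beta (α+1) (2*β + n + 1) / (β + 1) *
        ((poch (-α) k * poch (β+1) k * poch (2*β + n + 1) k) /
          (poch (β+2) k * poch (α + 2*β + n + 2) k * (Nat.factorial k))) := by
    have h1 := poch_div_poch_add_one (a := β + 1) (by linarith) k
    rw [show β + 1 + 1 = β + 2 by ring] at h1
    have h2 : 0 < β + 1 := by linarith
    have h3 : 0 < β + 1 + k := by positivity
    rw [show β + (β + n - 1) + 2 + k = 2 * β + n + 1 + k by ring,
      Beta_add_nat (by linarith) hb, show α + 1 + (2 * β + n + 1) = α + 2 * β + n + 2 by ring,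
      show poch (-α) k * poch (β+1) k * poch (2*β + n + 1) k /
          (poch (β+2) k * poch (α + 2*β + n + 2) k * (Nat.factorial k)) =
        poch (β + 1) k / poch (β + 2) k * (poch (-α) k * poch (2*β + n + 1) k /
          (poch (α + 2*β + n + 2) k * (Nat.factorial k))) by ring, h1,
      show β + k + 1 = β + 1 + k by ring]
    field_simp
  simp_rw [hterm] at h
  have h' := h.tsum_eq
  rw [tsum_mul_left] at h'
  rw [intervalIntegral.integral_of_le zero_le_one, integral_Ioc_eq_integral_Ioo,
    ← hfun_one hα hβ, ← div_div, div_mul_eq_mul_div, h', ← integral_div]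
  congr! 2 with r
  ring
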